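/- Let Q ⊆ ℝ^d be compact and arcwise connected, let μ be a finite signed Radon measure supported in Q with μ(Q) = 0, and let g satisfy: (A0) there is D > 0 such that any two points of Q are joined by a Lipschitz curve γ in Q with ∫₀¹ g(γ(t), γ'(t)) dt ≤ D; (A1) g is l.s.c., convex and positively 1-homogeneous in the second variable; (A2) g(x,t) ≥ c > 0 on Q × S^{d−1}. Then the problem min { ∫ g(x, dz/d|z|) d|z| : z ∈ M(ℝ^d;ℝ^d), spt z ⊆ Q, −div z = μ } is feasible and admits a minimizer. -/

import Mathlib

open MeasureTheory

/-- A vector measure on `ℝ^d`, encoded by its total variation `p.1` and unit polar density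
`p.2`, is admissible for the Beckmann-type problem if it is finite, supported in `Q`, and
satisfies `-div z = μ⁺ - μ⁻` distributionally. -/
def Admissible {d : ℕ} (Q : Set (EuclideanSpace ℝ (Fin d)))
    (μplus μminus : Measure (EuclideanSpace ℝ (Fin d)))
    (p : Measure (EuclideanSpace ℝ (Fin d)) ×
      (EuclideanSpace ℝ (Fin d) → EuclideanSpace ℝ (Fin d))) : Prop :=
  IsFiniteMeasure p.1 ∧ p.1 Qᶜ = 0 ∧ Measurable p.2 ∧ (∀ᵐ x ∂p.1, ‖p.2 x‖ = 1) ∧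
  ∀ ψ : EuclideanSpace ℝ (Fin d) → ℝ, ContDiff ℝ (⊤ : ℕ∞) ψ → HasCompactSupport ψ →
    ∫ x, (fderiv ℝ ψ x) (p.2 x) ∂p.1 = (∫ x, ψ x ∂μplus) - ∫ x, ψ x ∂μminus

section Beckmann

open Filter Topology Set
open scoped ENNReal

/-- Integration of a lower semicontinuous nonnegative function is lower semicontinuous for the weak
convergence of probability measures. -/
theorem lowerSemicontinuous_lintegral {X : Type*} [TopologicalSpace X]
    [TopologicalSpace.PseudoMetrizableSpace X] [TopologicalSpace.SeparableSpace X]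
    [MeasurableSpace X] [BorelSpace X] {f : X → ℝ≥0∞} (hf : LowerSemicontinuous f) :
    LowerSemicontinuous (fun P : ProbabilityMeasure X => ∫⁻ x, f x ∂(P : Measure X)) := by
  have trunc (n : ℕ) : LowerSemicontinuous
      (fun P : ProbabilityMeasure X => ∫⁻ x, min (f x) n ∂(P : Measure X)) := by
    have hopen (t : ℝ) : IsOpen {x | t < (min (f x) n).toReal} := by
      rcases lt_or_ge t 0 with ht | ht
      · convert isOpen_univ
        ext x
        simpa using ht.trans_le ENNReal.toReal_nonneg
      · have : {x | t < (min (f x) n).toReal} =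
            f ⁻¹' Ioi (ENNReal.ofReal t) ∩ {_x : X | ENNReal.ofReal t < n} := by
          ext x
          have hne : min (f x) (n : ℝ≥0∞) ≠ ∞ :=
            ne_top_of_le_ne_top (ENNReal.natCast_ne_top n) (min_le_right _ _)
          simp [← ENNReal.ofReal_lt_iff_lt_toReal ht hne]
        rw [this]
        exact (hf.isOpen_preimage _).inter isOpen_const
    have hcake (P : ProbabilityMeasure X) : ∫⁻ x, min (f x) n ∂(P : Measure X) =
        ∫⁻ t in Ioi (0 : ℝ), (P : Measure X) {x | t < (min (f x) n).toReal} := by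
      rw [← lintegral_eq_lintegral_meas_lt _ (Eventually.of_forall fun _ => ENNReal.toReal_nonneg)
        ((hf.measurable.min measurable_const).ennreal_toReal.aemeasurable)]
      refine lintegral_congr fun x => (ENNReal.ofReal_toReal ?_).symm
      exact ne_top_of_le_ne_top (ENNReal.natCast_ne_top n) (min_le_right _ _)
    simp_rw [hcake]
    intro P
    refine lowerSemicontinuousAt_iff_le_liminf.2 ?_
    by_contra! hlt
    obtain ⟨a, ha, haP⟩ := exists_between hlt
    have hfreq := frequently_lt_of_liminf_lt (by isBoundedDefault) ha
    obtain ⟨u, hu, hua⟩ := exists_seq_forall_of_frequently hfreq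
    have hfatou : ∫⁻ t in Ioi (0 : ℝ), (P : Measure X) {x | t < (min (f x) n).toReal} ≤
        liminf (fun k => ∫⁻ t in Ioi (0 : ℝ),
          (u k : Measure X) {x | t < (min (f x) n).toReal}) atTop :=
      (lintegral_mono fun t =>
        ProbabilityMeasure.le_liminf_measure_open_of_tendsto hu (hopen t)).trans
        (lintegral_liminf_le fun k => Antitone.measurable fun s t hst =>
          measure_mono fun x hx => lt_of_le_of_lt hst hx)
    have hle : liminf (fun k => ∫⁻ t in Ioi (0 : ℝ),
          (u k : Measure X) {x | t < (min (f x) n).toReal}) atTop ≤ a :=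
      liminf_le_of_frequently_le' (Frequently.of_forall fun k => (hua k).le)
    exact absurd haP (not_lt.2 (hfatou.trans hle))
  have hsup (P : ProbabilityMeasure X) : ∫⁻ x, f x ∂(P : Measure X) =
      ⨆ n : ℕ, ∫⁻ x, min (f x) n ∂(P : Measure X) := by
    rw [← lintegral_iSup (fun n => hf.measurable.min measurable_const)
      (fun i j hij x => min_le_min_left _ (by exact_mod_cast hij))]
    refine lintegral_congr fun x => ?_
    rw [← inf_iSup_eq, ENNReal.iSup_natCast, inf_top_eq]
  simp_rw [hsup]
  exact lowerSemicontinuous_iSup trunc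

/-- Jensen's inequality for a lower semicontinuous convex function with values in `[0, ∞]`. -/
theorem convex_lsc_map_integral_le {E : Type*} [NormedAddCommGroup E] [NormedSpace ℝ E]
    [CompleteSpace E] [MeasurableSpace E] [BorelSpace E] {f : E → ℝ≥0∞}
    (hf : LowerSemicontinuous f)
    (hconv : ∀ p q : E, ∀ a b : ℝ, 0 ≤ a → 0 ≤ b → a + b = 1 →
      f (a • p + b • q) ≤ ENNReal.ofReal a * f p + ENNReal.ofReal b * f q)
    (ν : Measure E) [IsProbabilityMeasure ν] (hν : Integrable (fun t => t) ν) :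
    f (∫ t, t ∂ν) ≤ ∫⁻ t, f t ∂ν := by
  rcases eq_or_ne (∫⁻ t, f t ∂ν) ∞ with htop | htop
  · simp [htop]
  set epi : Set (E × ℝ) := {y | f y.1 ≤ ENNReal.ofReal y.2 ∧ 0 ≤ y.2}
  have hclosed : IsClosed epi := by
    have h1 : IsClosed {y : E × ℝ | f y.1 ≤ ENNReal.ofReal y.2} :=
      hf.isClosed_epigraph.preimage
        (continuous_fst.prodMk (ENNReal.continuous_ofReal.comp continuous_snd))
    exact h1.inter (isClosed_le continuous_const continuous_snd)
  have hcvx : Convex ℝ epi := by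
    rintro ⟨p, r⟩ ⟨hp, hr⟩ ⟨q, s⟩ ⟨hq, hs⟩ a b ha hb hab
    dsimp only at hp hr hq hs
    refine ⟨?_, ?_⟩
    · calc f (a • p + b • q) ≤ ENNReal.ofReal a * f p + ENNReal.ofReal b * f q :=
            hconv p q a b ha hb hab
        _ ≤ ENNReal.ofReal a * ENNReal.ofReal r + ENNReal.ofReal b * ENNReal.ofReal s := by gcongr
        _ = ENNReal.ofReal (a * r + b * s) := by
            rw [ENNReal.ofReal_add (by positivity) (by positivity), ENNReal.ofReal_mul ha,
              ENNReal.ofReal_mul hb]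
    · change 0 ≤ a * r + b * s
      positivity
  have hintegrable : Integrable (fun t => (t, (f t).toReal)) ν :=
    hν.prodMk (integrable_toReal_of_lintegral_ne_top hf.measurable.aemeasurable htop)
  have hmem := hcvx.integral_mem (μ := ν) hclosed (f := fun t => (t, (f t).toReal)) ?_ hintegrable
  · rw [integral_pair hν (integrable_toReal_of_lintegral_ne_top hf.measurable.aemeasurable htop),
      integral_toReal hf.measurable.aemeasurable (ae_lt_top hf.measurable htop)] at hmem
    simpa [epi, ENNReal.ofReal_toReal htop] using hmem.1
  · filter_upwards [ae_lt_top hf.measurable htop] with t ht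
    exact ⟨by simp [ENNReal.ofReal_toReal ht.ne], ENNReal.toReal_nonneg⟩

/-- A linear functional dominated by the supremum of `T v` is represented by a probability
measure. -/
theorem exists_probabilityMeasure_integral_eq {X : Type*} [TopologicalSpace X] [CompactSpace X]
    [T2Space X] [Nonempty X] [MeasurableSpace X] [BorelSpace X]
    {V : Type*} [AddCommGroup V] [Module ℝ V] (T : V →ₗ[ℝ] C(X, ℝ)) (l : V →ₗ[ℝ] ℝ)
    (hl : ∀ v s, (∀ x, T v x ≤ s) → l v ≤ s) :
    ∃ P : ProbabilityMeasure X, ∀ v, ∫ x, T v x ∂(P : Measure X) = l v := by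
  have hbdd (f : C(X, ℝ)) : BddAbove (range f) := (isCompact_range f.continuous).bddAbove
  let S : V × C(X, ℝ) →ₗ[ℝ] C(X, ℝ) := T.coprod LinearMap.id
  let domain : Submodule ℝ (V × C(X, ℝ)) := (⊤ : Submodule ℝ V).prod ⊥
  obtain ⟨L, hLext, hLle⟩ := exists_extension_of_le_sublinear
    (E := V × C(X, ℝ)) ⟨domain, (l.comp (LinearMap.fst ℝ V C(X, ℝ))).comp domain.subtype⟩
    (fun w => ⨆ x, S w x)
    (fun c hc w => by simp [Real.mul_iSup_of_nonneg hc.le])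
    (fun w w' => ciSup_le fun x => by
      simpa using add_le_add (le_ciSup (hbdd (S w)) x) (le_ciSup (hbdd (S w')) x))
    (fun ⟨w, hw⟩ => hl _ _ fun x => by
      have hw2 : w.2 = 0 := by simpa [domain, Submodule.mem_prod] using hw
      simpa [S, hw2] using le_ciSup (hbdd (S w)) x)
  have hLbound (w : V × C(X, ℝ)) (s : ℝ) (hs : ∀ x, S w x ≤ s) : L w ≤ s :=
    (hLle w).trans (ciSup_le hs)
  have hLT (v : V) : L (0, T v) = l v := by
    have h1 : L (v, 0) = l v := hLext ⟨(v, 0), by simp [domain, Submodule.mem_prod]⟩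
    have h2 : L (v, -T v) ≤ 0 := hLbound _ _ fun x => by simp [S]
    have h3 : L (-v, T v) ≤ 0 := hLbound _ _ fun x => by simp [S]
    have h4 : L (v, -T v) = L (v, 0) - L (0, T v) := by rw [← map_sub]; simp
    have h5 : L (-v, T v) = L (0, T v) - L (v, 0) := by rw [← map_sub]; simp
    linarith
  let Λ : CompactlySupportedContinuousMap X ℝ →ₚ[ℝ] ℝ :=
    { toFun := fun f => L (0, (f : C(X, ℝ)))
      map_add' := fun f f' => by rw [← map_add]; congr 1; ext <;> simp
      map_smul' := fun r f => by rw [RingHom.id_apply, ← map_smul]; congr 1; ext <;> simp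
      monotone' := fun f f' hff' => by
        have h : L (0, (f : C(X, ℝ)) - (f' : C(X, ℝ))) ≤ 0 :=
          hLbound _ _ fun x => by simpa [S] using hff' x
        have h' : L (0, (f : C(X, ℝ)) - (f' : C(X, ℝ))) =
          L (0, (f : C(X, ℝ))) - L (0, (f' : C(X, ℝ))) := by rw [← map_sub]; simp
        change L (0, (f : C(X, ℝ))) ≤ L (0, (f' : C(X, ℝ)))
        linarith }
  have hintegrable (f : C(X, ℝ)) : ∫ x, f x ∂(RealRMK.rieszMeasure Λ) = L (0, f) :=
    RealRMK.integral_rieszMeasure Λ ⟨f, HasCompactSupport.of_compactSpace f⟩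
  have hone : L (0, 1) = 1 := by
    refine le_antisymm (hLbound _ _ fun x => by simp [S]) ?_
    have h : L (0, -1) ≤ -1 := hLbound _ _ fun x => by simp [S]
    have h' : L (0, -1) = - L (0, 1) := by rw [← map_neg]; simp
    linarith
  have hprob : IsProbabilityMeasure (RealRMK.rieszMeasure Λ) := by
    rw [isProbabilityMeasure_iff_real]
    simpa [hone] using hintegrable 1
  exact ⟨⟨RealRMK.rieszMeasure Λ, hprob⟩, fun v => (hintegrable (T v)).trans (hLT v)⟩

/-- The increment of `ψ` along a curve of length at most `B` is at most `A * B` if the derivative of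
`ψ` along the curve is bounded by `A`. -/
theorem sub_le_mul_of_lipschitz_curve {E : Type*} [NormedAddCommGroup E] [NormedSpace ℝ E]
    {ψ : E → ℝ} (hψ : ContDiff ℝ 1 ψ) (hψc : HasCompactSupport ψ) {γ γ' : ℝ → E} {K : NNReal}
    (hγ : LipschitzWith K γ)
    (hγ' : ∀ᵐ t ∂(volume.restrict (Icc (0 : ℝ) 1)), HasDerivAt γ (γ' t) t)
    {A B : ℝ} (hA : 0 ≤ A) (hB : 0 ≤ B)
    (hbound : ∀ t ∈ Icc (0 : ℝ) 1, ∀ v, fderiv ℝ ψ (γ t) v ≤ A * ‖v‖)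
    (hlen : ∫⁻ t in Icc (0 : ℝ) 1, ‖γ' t‖ₑ ≤ ENNReal.ofReal B) :
    ψ (γ 1) - ψ (γ 0) ≤ A * B := by
  obtain ⟨C, hC⟩ := hψ.lipschitzWith_of_hasCompactSupport hψc one_ne_zero
  have hac : AbsolutelyContinuousOnInterval (ψ ∘ γ) 0 1 :=
    ((hC.comp hγ).lipschitzOnWith (s := uIcc 0 1)).absolutelyContinuousOnInterval
  rw [show ψ (γ 1) - ψ (γ 0) = (ψ ∘ γ) 1 - (ψ ∘ γ) 0 from rfl, ← hac.integral_deriv_eq_sub,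
    intervalIntegral.integral_of_le zero_le_one, ← integral_Icc_eq_integral_Ioc]
  have hmem : ∀ᵐ t ∂(volume.restrict (Icc (0 : ℝ) 1)), t ∈ Icc (0 : ℝ) 1 :=
    ae_restrict_mem measurableSet_Icc
  have hae : ∀ᵐ t ∂(volume.restrict (Icc (0 : ℝ) 1)),
      ENNReal.ofReal (deriv (ψ ∘ γ) t) ≤ ENNReal.ofReal A * ‖γ' t‖ₑ := by
    filter_upwards [hγ', hmem] with t ht htI
    have hd := ((hψ.differentiable one_ne_zero (γ t)).hasFDerivAt.comp_hasDerivAt t ht).deriv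
    rw [hd, ← ofReal_norm, ← ENNReal.ofReal_mul hA]
    exact ENNReal.ofReal_le_ofReal (hbound t htI _)
  have hle : ∫⁻ t in Icc (0 : ℝ) 1, ENNReal.ofReal (deriv (ψ ∘ γ) t) ≤ ENNReal.ofReal (A * B) :=
    calc _ ≤ ∫⁻ t in Icc (0 : ℝ) 1, ENNReal.ofReal A * ‖γ' t‖ₑ := lintegral_mono_ae hae
      _ = ENNReal.ofReal A * ∫⁻ t in Icc (0 : ℝ) 1, ‖γ' t‖ₑ :=
          lintegral_const_mul' _ _ ENNReal.ofReal_ne_top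
      _ ≤ ENNReal.ofReal (A * B) := by
          rw [ENNReal.ofReal_mul hA]
          gcongr
  by_cases hi : Integrable (deriv (ψ ∘ γ)) (volume.restrict (Icc (0 : ℝ) 1))
  · calc ∫ t in Icc (0 : ℝ) 1, deriv (ψ ∘ γ) t
        ≤ (∫⁻ t in Icc (0 : ℝ) 1, ENNReal.ofReal (deriv (ψ ∘ γ) t)).toReal := by
          rw [integral_eq_lintegral_pos_part_sub_lintegral_neg_part hi]
          exact sub_le_self _ ENNReal.toReal_nonneg
      _ ≤ A * B := ENNReal.toReal_le_of_le_ofReal (by positivity) hle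
  · rw [integral_undef hi]
    positivity

/-- A measure on `ℝ^d × ℝ^d`, seen as a distribution of positions and velocities, transports
`μplus` to `μminus` if its first moment in the velocity has divergence `μminus - μplus`. -/
def IsLiftedFlow {d : ℕ} (μplus μminus : Measure (EuclideanSpace ℝ (Fin d)))
    (σ : Measure (EuclideanSpace ℝ (Fin d) × EuclideanSpace ℝ (Fin d))) : Prop :=
  ∀ ψ : EuclideanSpace ℝ (Fin d) → ℝ, ContDiff ℝ (⊤ : ℕ∞) ψ → HasCompactSupport ψ →
    ∫ y, (fderiv ℝ ψ y.1) y.2 ∂σ = (∫ x, ψ x ∂μplus) - ∫ x, ψ x ∂μminus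

theorem continuous_fderiv_apply_pair {E : Type*} [NormedAddCommGroup E] [NormedSpace ℝ E]
    {ψ : E → ℝ} (hψ : ContDiff ℝ (⊤ : ℕ∞) ψ) :
    Continuous (fun y : E × E => (fderiv ℝ ψ y.1) y.2) :=
  ((hψ.continuous_fderiv (by simp)).comp continuous_fst).clm_apply continuous_snd

/-- Averaging the velocities of a lifted flow gives an admissible vector measure of no
larger energy. -/
theorem IsLiftedFlow.exists_admissible {d : ℕ} {Q : Set (EuclideanSpace ℝ (Fin d))}
    (hQ : IsCompact Q) {g : EuclideanSpace ℝ (Fin d) → EuclideanSpace ℝ (Fin d) → ℝ≥0∞}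
    (hlsc : LowerSemicontinuous
      (fun p : EuclideanSpace ℝ (Fin d) × EuclideanSpace ℝ (Fin d) => g p.1 p.2))
    (hconv : ∀ x p q : EuclideanSpace ℝ (Fin d), ∀ a b : ℝ, 0 ≤ a → 0 ≤ b → a + b = 1 →
      g x (a • p + b • q) ≤ ENNReal.ofReal a * g x p + ENNReal.ofReal b * g x q)
    (hhom : ∀ (x : EuclideanSpace ℝ (Fin d)) (lam : ℝ), 0 < lam → ∀ t,
      g x (lam • t) = ENNReal.ofReal lam * g x t)
    {μplus μminus : Measure (EuclideanSpace ℝ (Fin d))}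
    {σ : Measure (EuclideanSpace ℝ (Fin d) × EuclideanSpace ℝ (Fin d))} [IsFiniteMeasure σ]
    {R : ℝ} (hσ : ∀ᵐ y ∂σ, y ∈ Q ×ˢ Metric.closedBall 0 R)
    (hflow : IsLiftedFlow μplus μminus σ) :
    ∃ p, Admissible Q μplus μminus p ∧ ∫⁻ x, g x (p.2 x) ∂p.1 ≤ ∫⁻ y, g y.1 y.2 ∂σ := by
  have hR : ∀ᵐ x ∂σ.fst, ∀ᵐ t ∂σ.condKernel x, ‖t‖ ≤ R := by
    refine Measure.ae_ae_of_ae_compProd (p := fun y => ‖y.2‖ ≤ R) ?_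
    rw [σ.disintegrate]
    filter_upwards [hσ] with y hy
    simpa using hy.2
  have hintegrable : ∀ᵐ x ∂σ.fst, Integrable (fun t => t) (σ.condKernel x) := by
    filter_upwards [hR] with x hx
    exact Integrable.of_bound aestronglyMeasurable_id R hx
  set v : EuclideanSpace ℝ (Fin d) → EuclideanSpace ℝ (Fin d) :=
    fun x => ∫ t, t ∂σ.condKernel x with hv
  have hvm : Measurable v :=
    (StronglyMeasurable.integral_kernel_prod_right' (κ := σ.condKernel)
      (f := fun y : EuclideanSpace ℝ (Fin d) × EuclideanSpace ℝ (Fin d) => y.2)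
      measurable_snd.stronglyMeasurable).measurable
  have hvR : ∀ᵐ x ∂σ.fst, ‖v x‖ ≤ R := by
    filter_upwards [hR] with x hx
    simpa using norm_integral_le_of_norm_le_const hx
  refine ⟨(σ.fst.withDensity fun x => (‖v x‖₊ : ℝ≥0∞), fun x => ‖v x‖⁻¹ • v x),
    ⟨?_, ?_, ?_, ?_, ?_⟩, ?_⟩
  · refine isFiniteMeasure_withDensity (ne_top_of_le_ne_top ?_
      (lintegral_mono_ae (g := fun _ => ENNReal.ofReal R) ?_))
    · simp [ENNReal.mul_eq_top]
    · filter_upwards [hvR] with x hx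
      rw [← enorm_eq_nnnorm, ← ofReal_norm]
      exact ENNReal.ofReal_le_ofReal hx
  · refine withDensity_absolutelyContinuous _ _ ?_
    rw [Measure.fst_apply hQ.measurableSet.compl]
    have hfst : ∀ᵐ y ∂σ, y.1 ∈ Q := hσ.mono fun y hy => hy.1
    exact hfst
  · exact hvm.norm.inv.smul hvm
  · rw [ae_withDensity_iff (by fun_prop)]
    refine Eventually.of_forall fun x hx => ?_
    have : ‖v x‖ ≠ 0 := by simpa using hx
    simp [norm_smul, this]
  · intro ψ hψ hψc
    rw [← hflow ψ hψ hψc]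
    have hDint : Integrable (fun y : EuclideanSpace ℝ (Fin d) × EuclideanSpace ℝ (Fin d) =>
        (fderiv ℝ ψ y.1) y.2) σ := by
      obtain ⟨C, hC⟩ := (hQ.prod (isCompact_closedBall (0 : EuclideanSpace ℝ (Fin d)) R))
        |>.exists_bound_of_continuousOn (continuous_fderiv_apply_pair hψ).continuousOn
      exact Integrable.of_bound (continuous_fderiv_apply_pair hψ).aestronglyMeasurable C
        (hσ.mono hC)
    rw [← Measure.integral_condKernel hDint]
    dsimp only
    rw [integral_withDensity_eq_integral_smul hvm.nnnorm]
    refine integral_congr_ae ?_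
    filter_upwards [hintegrable] with x hx
    rw [ContinuousLinearMap.integral_comp_comm _ hx]
    change ‖v x‖₊ • fderiv ℝ ψ x (‖v x‖⁻¹ • v x) = fderiv ℝ ψ x (v x)
    rcases eq_or_ne (v x) 0 with h0 | h0
    · simp [h0]
    · rw [NNReal.smul_def, coe_nnnorm, ← map_smul, smul_inv_smul₀ (norm_ne_zero_iff.2 h0)]
  · dsimp only
    have hgm : Measurable fun x => g x (‖v x‖⁻¹ • v x) :=
      hlsc.measurable.comp (measurable_id.prodMk (hvm.norm.inv.smul hvm))
    rw [lintegral_withDensity_eq_lintegral_mul _ (by fun_prop) hgm,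
      ← Measure.lintegral_condKernel hlsc.measurable]
    refine lintegral_mono_ae ?_
    filter_upwards [hintegrable] with x hx
    refine le_trans ?_ (convex_lsc_map_integral_le
      (hlsc.comp (continuous_const.prodMk continuous_id : Continuous fun t => (x, t)))
      (hconv x) (σ.condKernel x) hx)
    rcases eq_or_ne (v x) 0 with h0 | h0
    · simp [h0]
    · change (‖v x‖₊ : ℝ≥0∞) * g x (‖v x‖⁻¹ • v x) ≤ g x (v x)
      have hpos : 0 < ‖v x‖ := norm_pos_iff.2 h0
      rw [hhom x _ (inv_pos.2 hpos), ← mul_assoc, ENNReal.ofReal_inv_of_pos hpos,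
        ofReal_norm, enorm_eq_nnnorm, ENNReal.mul_inv_cancel (by simpa using h0) (by simp), one_mul]

/-- A nonzero admissible vector measure lifts to a probability measure of the same energy. -/
theorem Admissible.exists_isLiftedFlow {d : ℕ} {Q : Set (EuclideanSpace ℝ (Fin d))}
    (hQ : IsCompact Q) {g : EuclideanSpace ℝ (Fin d) → EuclideanSpace ℝ (Fin d) → ℝ≥0∞}
    (hlsc : LowerSemicontinuous
      (fun p : EuclideanSpace ℝ (Fin d) × EuclideanSpace ℝ (Fin d) => g p.1 p.2))
    (hhom : ∀ (x : EuclideanSpace ℝ (Fin d)) (lam : ℝ), 0 < lam → ∀ t,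
      g x (lam • t) = ENNReal.ofReal lam * g x t)
    {μplus μminus : Measure (EuclideanSpace ℝ (Fin d))}
    {p : Measure (EuclideanSpace ℝ (Fin d)) ×
      (EuclideanSpace ℝ (Fin d) → EuclideanSpace ℝ (Fin d))}
    (hp : Admissible Q μplus μminus p) (hp0 : p.1 ≠ 0) {R : ℝ} (hR : p.1.real univ ≤ R) :
    ∃ σ : Measure (EuclideanSpace ℝ (Fin d) × EuclideanSpace ℝ (Fin d)),
      IsProbabilityMeasure σ ∧ (∀ᵐ y ∂σ, y ∈ Q ×ˢ Metric.closedBall 0 R) ∧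
      IsLiftedFlow μplus μminus σ ∧ ∫⁻ y, g y.1 y.2 ∂σ = ∫⁻ x, g x (p.2 x) ∂p.1 := by
  obtain ⟨hfin, hpQ, hpm, hunit, hdiv⟩ := hp
  have : NeZero p.1 := ⟨hp0⟩
  set m : ℝ := p.1.real univ with hm
  have hmpos : 0 < m := measureReal_univ_pos
  have hmtop : (p.1 univ)⁻¹ ≠ ∞ := by simpa using hp0
  have hlift : Measurable fun x => (x, m • p.2 x) := measurable_id.prodMk (hpm.const_smul m)
  refine ⟨((p.1 univ)⁻¹ • p.1).map fun x => (x, m • p.2 x), ?_, ?_, ?_, ?_⟩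
  · exact Measure.isProbabilityMeasure_map hlift.aemeasurable
  · have hpQ' : ∀ᵐ x ∂p.1, x ∈ Q := hpQ
    refine (mem_ae_map_iff hlift.aemeasurable
      (hQ.measurableSet.prod Metric.isClosed_closedBall.measurableSet)).2 ?_
    refine Measure.smul_absolutelyContinuous.ae_le ?_
    filter_upwards [hpQ', hunit] with x hx hx1
    exact ⟨hx, by simpa [norm_smul, hx1, abs_of_pos hmpos] using hR⟩
  · intro ψ hψ hψc
    rw [← hdiv ψ hψ hψc, integral_map hlift.aemeasurable
      (continuous_fderiv_apply_pair hψ).aestronglyMeasurable, integral_smul_measure]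
    simp only [map_smul, integral_const_mul, smul_eq_mul]
    rw [← mul_assoc, ENNReal.toReal_inv, ← measureReal_def, ← hm,
      inv_mul_cancel₀ hmpos.ne', one_mul]
  · rw [lintegral_map hlsc.measurable hlift, lintegral_smul_measure]
    simp only [hhom _ m hmpos]
    rw [lintegral_const_mul' _ _ ENNReal.ofReal_ne_top, smul_eq_mul, ← mul_assoc, hm,
      ofReal_measureReal, ENNReal.inv_mul_cancel (by simpa using hp0) (measure_ne_top _ _), one_mul]

theorem exists_probabilityMeasure_map_subtype_val {α : Type*} [MeasurableSpace α] {K : Set α}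
    (hK : MeasurableSet K) (σ : Measure α) [IsProbabilityMeasure σ] (hσ : ∀ᵐ y ∂σ, y ∈ K) :
    ∃ P : ProbabilityMeasure K, (P : Measure K).map Subtype.val = σ := by
  have hmap : (σ.comap (Subtype.val : K → α)).map Subtype.val = σ := by
    rw [map_comap_subtype_coe hK, Measure.restrict_eq_self_of_ae_mem hσ]
  refine ⟨⟨σ.comap Subtype.val, ⟨?_⟩⟩, hmap⟩
  rw [← measure_univ (μ := σ), ← hmap, Measure.map_apply measurable_subtype_coe .univ,
    preimage_univ]
  simp [hmap]

theorem isLiftedFlow_map_subtype_val_iff {d : ℕ} {μplus μminus : Measure (EuclideanSpace ℝ (Fin d))}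
    {K : Set (EuclideanSpace ℝ (Fin d) × EuclideanSpace ℝ (Fin d))} {P : Measure K} :
    IsLiftedFlow μplus μminus (P.map Subtype.val) ↔
      ∀ ψ : EuclideanSpace ℝ (Fin d) → ℝ, ContDiff ℝ (⊤ : ℕ∞) ψ → HasCompactSupport ψ →
        ∫ y : K, (fderiv ℝ ψ y.1.1) y.1.2 ∂P = (∫ x, ψ x ∂μplus) - ∫ x, ψ x ∂μminus := by
  refine forall_congr' fun ψ => forall_congr' fun hψ => ?_
  rw [integral_map measurable_subtype_coe.aemeasurable
    (continuous_fderiv_apply_pair hψ).aestronglyMeasurable]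

/-- Smooth compactly supported real functions. -/
def smoothCompactlySupported (E : Type*) [NormedAddCommGroup E] [NormedSpace ℝ E] :
    Submodule ℝ (E → ℝ) where
  carrier := {ψ | ContDiff ℝ (⊤ : ℕ∞) ψ ∧ HasCompactSupport ψ}
  add_mem' hψ hφ := ⟨hψ.1.add hφ.1, hψ.2.add hφ.2⟩
  zero_mem' := ⟨contDiff_const, HasCompactSupport.zero⟩
  smul_mem' r _ hψ := ⟨contDiff_const.smul hψ.1, hψ.2.smul_left (f := fun _ => r)⟩

theorem integral_sub_integral_le_of_oscillation {α : Type*} [TopologicalSpace α]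
    [MeasurableSpace α] [OpensMeasurableSpace α] {Q : Set α} (hQ : IsCompact Q)
    (hQne : Q.Nonempty) {μ ν : Measure α} [IsFiniteMeasure μ] [IsFiniteMeasure ν]
    (hμ : μ Qᶜ = 0) (hν : ν Qᶜ = 0) (hbal : μ univ = ν univ) {ψ : α → ℝ} (hψ : Continuous ψ)
    {C : ℝ} (hC : ∀ x ∈ Q, ∀ y ∈ Q, ψ y - ψ x ≤ C) :
    (∫ x, ψ x ∂μ) - ∫ x, ψ x ∂ν ≤ μ.real univ * C := by
  obtain ⟨x, hx, hxmin⟩ := hQ.exists_isMinOn hQne hψ.continuousOn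
  obtain ⟨y, hy, hymax⟩ := hQ.exists_isMaxOn hQne hψ.continuousOn
  obtain ⟨b, hb⟩ := hQ.exists_bound_of_continuousOn hψ.continuousOn
  have hμQ : ∀ᵐ z ∂μ, z ∈ Q := hμ
  have hνQ : ∀ᵐ z ∂ν, z ∈ Q := hν
  have h1 : ∫ z, ψ z ∂μ ≤ ∫ _, ψ y ∂μ :=
    integral_mono_ae (.of_bound hψ.aestronglyMeasurable b (hμQ.mono hb)) (integrable_const _)
      (hμQ.mono fun z hz => hymax hz)
  have h2 : ∫ _, ψ x ∂ν ≤ ∫ z, ψ z ∂ν :=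
    integral_mono_ae (integrable_const _) (.of_bound hψ.aestronglyMeasurable b (hνQ.mono hb))
      (hνQ.mono fun z hz => hxmin hz)
  have hreal : ν.real univ = μ.real univ := by simp [measureReal_def, hbal]
  simp only [integral_const, smul_eq_mul, hreal] at h1 h2
  nlinarith [hC x hx y hy, measureReal_nonneg (μ := μ) (s := univ)]

/-- A lifted flow exists as soon as the oscillation of test functions on `Q` is controlled by their
derivatives on `Q`. -/
theorem exists_isLiftedFlow {d : ℕ} {Q : Set (EuclideanSpace ℝ (Fin d))}
    (hQ : IsCompact Q) (hQne : Q.Nonempty) {μplus μminus : Measure (EuclideanSpace ℝ (Fin d))}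
    [IsFiniteMeasure μplus] [IsFiniteMeasure μminus] (hsptp : μplus Qᶜ = 0)
    (hsptm : μminus Qᶜ = 0) (hbal : μplus univ = μminus univ) {B : ℝ} (hB : 0 ≤ B)
    (hosc : ∀ ψ : EuclideanSpace ℝ (Fin d) → ℝ, ContDiff ℝ (⊤ : ℕ∞) ψ → HasCompactSupport ψ →
      ∀ A : ℝ, 0 ≤ A → (∀ x ∈ Q, ∀ v, fderiv ℝ ψ x v ≤ A * ‖v‖) →
      ∀ x ∈ Q, ∀ y ∈ Q, ψ y - ψ x ≤ A * B) :
    ∃ (R : ℝ) (σ : Measure (EuclideanSpace ℝ (Fin d) × EuclideanSpace ℝ (Fin d))),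
      IsProbabilityMeasure σ ∧ (∀ᵐ y ∂σ, y ∈ Q ×ˢ Metric.closedBall 0 R) ∧
      IsLiftedFlow μplus μminus σ := by
  set R : ℝ := μplus.real univ * B + 1 with hRdef
  have hR : 0 < R := by positivity
  set K := Q ×ˢ Metric.closedBall (0 : EuclideanSpace ℝ (Fin d)) R with hK
  have hKc : IsCompact K := hQ.prod (isCompact_closedBall _ _)
  have : CompactSpace K := isCompact_iff_compactSpace.1 hKc
  obtain ⟨x₀, hx₀⟩ := hQne
  have : Nonempty K := ⟨⟨(x₀, 0), hx₀, by simpa using hR.le⟩⟩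
  have hdiff (ψ : smoothCompactlySupported (EuclideanSpace ℝ (Fin d))) :
      Differentiable ℝ ψ.1 := ψ.2.1.differentiable (by simp)
  have hintegrable (ψ : smoothCompactlySupported (EuclideanSpace ℝ (Fin d)))
      (μ : Measure (EuclideanSpace ℝ (Fin d))) [IsFiniteMeasure μ] : Integrable ψ.1 μ :=
    ψ.2.1.continuous.integrable_of_hasCompactSupport ψ.2.2
  let T : smoothCompactlySupported (EuclideanSpace ℝ (Fin d)) →ₗ[ℝ] C(K, ℝ) :=
    { toFun := fun ψ => ⟨fun y => fderiv ℝ ψ.1 y.1.1 y.1.2,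
        (continuous_fderiv_apply_pair ψ.2.1).comp continuous_subtype_val⟩
      map_add' := fun ψ φ => by
        ext y
        simp [fderiv_add (hdiff ψ y.1.1) (hdiff φ y.1.1)]
      map_smul' := fun r ψ => by
        ext y
        simp [fderiv_const_smul (hdiff ψ y.1.1)] }
  let l : smoothCompactlySupported (EuclideanSpace ℝ (Fin d)) →ₗ[ℝ] ℝ :=
    { toFun := fun ψ => (∫ x, ψ.1 x ∂μplus) - ∫ x, ψ.1 x ∂μminus
      map_add' := fun ψ φ => by
        simp only [Submodule.coe_add, Pi.add_apply]
        rw [integral_add (hintegrable ψ _) (hintegrable φ _),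
          integral_add (hintegrable ψ _) (hintegrable φ _)]
        ring
      map_smul' := fun r ψ => by
        simp [integral_const_mul, mul_sub] }
  obtain ⟨P, hP⟩ := exists_probabilityMeasure_integral_eq T l fun ψ s hs => by
    have hs' : ∀ x ∈ Q, ∀ v, ‖v‖ ≤ R → fderiv ℝ ψ.1 x v ≤ s := fun x hx v hv =>
      hs ⟨(x, v), hx, by simpa using hv⟩
    have hs0 : 0 ≤ s := by simpa using hs' x₀ hx₀ 0 (by simpa using hR.le)
    have hA : 0 ≤ s / R := by positivity
    have hbound : ∀ x ∈ Q, ∀ v, fderiv ℝ ψ.1 x v ≤ s / R * ‖v‖ := fun x hx v => by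
      rcases eq_or_ne v 0 with rfl | hv
      · simp
      have hv' : 0 < ‖v‖ := norm_pos_iff.2 hv
      have h := hs' x hx ((R / ‖v‖) • v) (by
        rw [norm_smul, Real.norm_of_nonneg (by positivity), div_mul_cancel₀ _ hv'.ne'])
      rw [map_smul, smul_eq_mul] at h
      calc fderiv ℝ ψ.1 x v = (R / ‖v‖ * fderiv ℝ ψ.1 x v) * (‖v‖ / R) := by field_simp
        _ ≤ s * (‖v‖ / R) := by gcongr
        _ = s / R * ‖v‖ := by ring
    have h := integral_sub_integral_le_of_oscillation hQ ⟨x₀, hx₀⟩ hsptp hsptm hbal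
      ψ.2.1.continuous (hosc ψ.1 ψ.2.1 ψ.2.2 (s / R) hA hbound)
    calc l ψ ≤ μplus.real univ * (s / R * B) := h
      _ = (R - 1) * (s / R) := by rw [hRdef]; ring
      _ ≤ R * (s / R) := by gcongr; linarith
      _ = s := by field_simp
  exact ⟨R, (P : Measure K).map Subtype.val,
    Measure.isProbabilityMeasure_map measurable_subtype_coe.aemeasurable,
    (mem_ae_map_iff measurable_subtype_coe.aemeasurable hKc.measurableSet).2
      (Eventually.of_forall fun y => y.2),
    isLiftedFlow_map_subtype_val_iff.2 fun ψ hψ hψc => hP ⟨ψ, hψ, hψc⟩⟩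

theorem mul_enorm_le_of_homogeneous {E : Type*} [NormedAddCommGroup E] [NormedSpace ℝ E]
    {f : E → ℝ≥0∞} (hhom : ∀ lam : ℝ, 0 < lam → ∀ t, f (lam • t) = ENNReal.ofReal lam * f t)
    {a : ℝ≥0∞} (ha : ∀ t, ‖t‖ = 1 → a ≤ f t) (t : E) : a * ‖t‖ₑ ≤ f t := by
  rcases eq_or_ne t 0 with rfl | ht
  · simp
  have hpos : 0 < ‖t‖ := norm_pos_iff.2 ht
  calc a * ‖t‖ₑ ≤ f (‖t‖⁻¹ • t) * ‖t‖ₑ := by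
        gcongr
        exact ha _ (by simp [norm_smul, ht])
    _ = f (‖t‖ • ‖t‖⁻¹ • t) := by rw [hhom _ hpos (‖t‖⁻¹ • t), ofReal_norm, mul_comm]
    _ = f t := by rw [smul_inv_smul₀ (norm_ne_zero_iff.2 ht)]

/-- Among the lifted probability measures with velocities bounded by `R`, one has minimal energy. -/
theorem exists_minimal_isLiftedFlow {d : ℕ} {Q : Set (EuclideanSpace ℝ (Fin d))}
    (hQ : IsCompact Q) {g : EuclideanSpace ℝ (Fin d) → EuclideanSpace ℝ (Fin d) → ℝ≥0∞}
    (hlsc : LowerSemicontinuous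
      (fun p : EuclideanSpace ℝ (Fin d) × EuclideanSpace ℝ (Fin d) => g p.1 p.2))
    {μplus μminus : Measure (EuclideanSpace ℝ (Fin d))} {R : ℝ}
    (hne : ∃ σ : Measure (EuclideanSpace ℝ (Fin d) × EuclideanSpace ℝ (Fin d)),
      IsProbabilityMeasure σ ∧ (∀ᵐ y ∂σ, y ∈ Q ×ˢ Metric.closedBall 0 R) ∧
      IsLiftedFlow μplus μminus σ) :
    ∃ σ : Measure (EuclideanSpace ℝ (Fin d) × EuclideanSpace ℝ (Fin d)),
      IsProbabilityMeasure σ ∧ (∀ᵐ y ∂σ, y ∈ Q ×ˢ Metric.closedBall 0 R) ∧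
      IsLiftedFlow μplus μminus σ ∧
      ∀ τ : Measure (EuclideanSpace ℝ (Fin d) × EuclideanSpace ℝ (Fin d)),
        IsProbabilityMeasure τ → (∀ᵐ y ∂τ, y ∈ Q ×ˢ Metric.closedBall 0 R) →
        IsLiftedFlow μplus μminus τ → ∫⁻ y, g y.1 y.2 ∂σ ≤ ∫⁻ y, g y.1 y.2 ∂τ := by
  set K := Q ×ˢ Metric.closedBall (0 : EuclideanSpace ℝ (Fin d)) R with hK
  have hKc : IsCompact K := hQ.prod (isCompact_closedBall _ _)
  have : CompactSpace K := isCompact_iff_compactSpace.1 hKc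
  let F : Set (ProbabilityMeasure K) :=
    {P | IsLiftedFlow μplus μminus ((P : Measure K).map Subtype.val)}
  have hF : IsClosed F := by
    simp only [F, isLiftedFlow_map_subtype_val_iff, ofPred_forall]
    refine isClosed_iInter fun ψ => isClosed_iInter fun hψ => isClosed_iInter fun _ => ?_
    exact isClosed_eq (ProbabilityMeasure.continuous_integral_boundedContinuousFunction
      (BoundedContinuousFunction.mkOfCompact ⟨fun y : K => fderiv ℝ ψ y.1.1 y.1.2,
        (continuous_fderiv_apply_pair hψ).comp continuous_subtype_val⟩)) continuous_const
  have hFne : F.Nonempty := by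
    obtain ⟨σ, hσ, hσK, hflow⟩ := hne
    obtain ⟨P, hP⟩ := exists_probabilityMeasure_map_subtype_val hKc.measurableSet σ hσK
    exact ⟨P, by simpa [F, hP] using hflow⟩
  have henergy (P : ProbabilityMeasure K) : ∫⁻ y : K, g y.1.1 y.1.2 ∂(P : Measure K) =
      ∫⁻ y, g y.1 y.2 ∂((P : Measure K).map Subtype.val) :=
    (lintegral_map hlsc.measurable measurable_subtype_coe).symm
  obtain ⟨P, hPF, hPmin⟩ := ((lowerSemicontinuous_lintegral
    (hlsc.comp (continuous_subtype_val (p := (· ∈ K))))).lowerSemicontinuousOn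
      F).exists_isMinOn hFne hF.isCompact
  refine ⟨(P : Measure K).map Subtype.val,
    Measure.isProbabilityMeasure_map measurable_subtype_coe.aemeasurable, ?_, hPF, ?_⟩
  · exact (mem_ae_map_iff measurable_subtype_coe.aemeasurable hKc.measurableSet).2
      (Eventually.of_forall fun y => y.2)
  · intro τ hτ hτK hflow
    obtain ⟨P', hP'⟩ := exists_probabilityMeasure_map_subtype_val hKc.measurableSet τ hτK
    rw [← henergy P, ← hP', ← henergy P']
    exact hPmin (show P' ∈ F by simpa [F, hP'] using hflow)

theorem Admissible.mul_measure_univ_le {d : ℕ} {Q : Set (EuclideanSpace ℝ (Fin d))}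
    {μplus μminus : Measure (EuclideanSpace ℝ (Fin d))}
    {p : Measure (EuclideanSpace ℝ (Fin d)) ×
      (EuclideanSpace ℝ (Fin d) → EuclideanSpace ℝ (Fin d))}
    (hp : Admissible Q μplus μminus p)
    {g : EuclideanSpace ℝ (Fin d) → EuclideanSpace ℝ (Fin d) → ℝ≥0∞} {a : ℝ≥0∞}
    (hlow : ∀ x ∈ Q, ∀ t : EuclideanSpace ℝ (Fin d), ‖t‖ = 1 → a ≤ g x t) :
    a * p.1 univ ≤ ∫⁻ x, g x (p.2 x) ∂p.1 := by
  obtain ⟨-, hpQ, -, hunit, -⟩ := hp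
  have hpQ' : ∀ᵐ x ∂p.1, x ∈ Q := hpQ
  rw [← lintegral_const]
  refine lintegral_mono_ae ?_
  filter_upwards [hpQ', hunit] with x hx hx1 using hlow x hx _ hx1

theorem setLIntegral_enorm_le_of_energy_le {E : Type*} [NormedAddCommGroup E] [NormedSpace ℝ E]
    {Q : Set E} {g : E → E → ℝ≥0∞}
    (hhom : ∀ (x : E) (lam : ℝ), 0 < lam → ∀ t, g x (lam • t) = ENNReal.ofReal lam * g x t)
    {c D : ℝ} (hc : 0 < c) (hlow : ∀ x ∈ Q, ∀ t : E, ‖t‖ = 1 → ENNReal.ofReal c ≤ g x t)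
    {γ γ' : ℝ → E} (hγQ : ∀ t ∈ Icc (0 : ℝ) 1, γ t ∈ Q)
    (henergy : ∫⁻ t in Icc (0 : ℝ) 1, g (γ t) (γ' t) ≤ ENNReal.ofReal D) :
    ∫⁻ t in Icc (0 : ℝ) 1, ‖γ' t‖ₑ ≤ ENNReal.ofReal (D / c) := by
  rw [ENNReal.ofReal_div_of_pos hc, ENNReal.le_div_iff_mul_le (by simp [hc]) (by simp), mul_comm,
    ← lintegral_const_mul' _ _ ENNReal.ofReal_ne_top]
  refine (lintegral_mono_ae ?_).trans henergy
  filter_upwards [ae_restrict_mem measurableSet_Icc] with t ht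
  exact mul_enorm_le_of_homogeneous (hhom (γ t)) (hlow (γ t) (hγQ t ht)) (γ' t)

end Beckmann

/-- Under (A0) (uniformly bounded-energy curves joining any two points of `Q`), (A1)
(lower semicontinuity, convexity and positive 1-homogeneity of `g` in its second variable)
and (A2) (uniform lower bound on the unit sphere over `Q`), the problem
`min {∫ g(x, dz/d|z|) d|z| : spt z ⊆ Q, -div z = μ}` with `μ = μ⁺ - μ⁻` balanced and
supported in `Q` is feasible and admits a minimizer. -/
theorem stmt13 {d : ℕ} (Q : Set (EuclideanSpace ℝ (Fin d)))
    (hQc : IsCompact Q) (hQconn : IsPathConnected Q)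
    (g : EuclideanSpace ℝ (Fin d) → EuclideanSpace ℝ (Fin d) → ENNReal)
    (hlsc : LowerSemicontinuous
      (fun p : EuclideanSpace ℝ (Fin d) × EuclideanSpace ℝ (Fin d) => g p.1 p.2))
    (hconv : ∀ x p q : EuclideanSpace ℝ (Fin d), ∀ a b : ℝ, 0 ≤ a → 0 ≤ b → a + b = 1 →
      g x (a • p + b • q) ≤ ENNReal.ofReal a * g x p + ENNReal.ofReal b * g x q)
    (hhom : ∀ (x : EuclideanSpace ℝ (Fin d)) (lam : ℝ), 0 < lam → ∀ t,
      g x (lam • t) = ENNReal.ofReal lam * g x t)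
    (c : ℝ) (hc : 0 < c)
    (hlow : ∀ x ∈ Q, ∀ t : EuclideanSpace ℝ (Fin d), ‖t‖ = 1 →
      ENNReal.ofReal c ≤ g x t)
    (D : ℝ) (hD : 0 < D)
    (hA0 : ∀ x ∈ Q, ∀ y ∈ Q,
      ∃ (γ γ' : ℝ → EuclideanSpace ℝ (Fin d)) (K : NNReal),
        LipschitzWith K γ ∧ γ 0 = x ∧ γ 1 = y ∧
        (∀ t ∈ Set.Icc (0 : ℝ) 1, γ t ∈ Q) ∧
        (∀ᵐ t ∂(volume.restrict (Set.Icc (0 : ℝ) 1)), HasDerivAt γ (γ' t) t) ∧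
        ∫⁻ t in Set.Icc (0 : ℝ) 1, g (γ t) (γ' t) ≤ ENNReal.ofReal D)
    (μplus μminus : Measure (EuclideanSpace ℝ (Fin d)))
    [IsFiniteMeasure μplus] [IsFiniteMeasure μminus]
    (hsptp : μplus Qᶜ = 0) (hsptm : μminus Qᶜ = 0)
    (hbal : μplus Set.univ = μminus Set.univ) :
    (∃ p, Admissible Q μplus μminus p) ∧
    ∃ p, Admissible Q μplus μminus p ∧
      ∀ q, Admissible Q μplus μminus q →
        ∫⁻ x, g x (p.2 x) ∂p.1 ≤ ∫⁻ x, g x (q.2 x) ∂q.1 := by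
  have hfeas : ∃ p, Admissible Q μplus μminus p := by
    obtain ⟨R, σ, hσ, hσK, hflow⟩ := exists_isLiftedFlow hQc hQconn.nonempty hsptp hsptm hbal
      (div_nonneg hD.le hc.le) fun ψ hψ hψc A hA hbound x hx y hy => by
        obtain ⟨γ, γ', K, hγ, rfl, rfl, hγQ, hγ', henergy⟩ := hA0 x hx y hy
        exact sub_le_mul_of_lipschitz_curve (hψ.of_le (by simp)) hψc hγ hγ' hA
          (div_nonneg hD.le hc.le) (fun t ht => hbound (γ t) (hγQ t ht))
          (setLIntegral_enorm_le_of_energy_le hhom hc hlow hγQ henergy)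
    obtain ⟨p, hp, -⟩ := hflow.exists_admissible hQc hlsc hconv hhom hσK
    exact ⟨p, hp⟩
  refine ⟨hfeas, ?_⟩
  by_cases htop : ∀ q, Admissible Q μplus μminus q → ∫⁻ x, g x (q.2 x) ∂q.1 = ⊤
  · obtain ⟨p, hp⟩ := hfeas
    exact ⟨p, hp, fun q hq => by simp [htop q hq]⟩
  by_cases hzero : ∃ p, Admissible Q μplus μminus p ∧ p.1 = 0
  · obtain ⟨p, hp, hp0⟩ := hzero
    exact ⟨p, hp, fun q _ => by simp [hp0]⟩
  push Not at htop hzero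
  obtain ⟨q₀, hq₀, hq₀top⟩ := htop
  set e₀ := ∫⁻ x, g x (q₀.2 x) ∂q₀.1 with he₀
  have hmass : ∀ q, Admissible Q μplus μminus q → ∫⁻ x, g x (q.2 x) ∂q.1 ≤ e₀ →
      q.1.real Set.univ ≤ e₀.toReal / c := fun q hq hqe => by
    have h := ENNReal.toReal_mono hq₀top ((hq.mul_measure_univ_le hlow).trans hqe)
    rw [ENNReal.toReal_mul, ENNReal.toReal_ofReal hc.le] at h
    rwa [le_div_iff₀ hc, mul_comm]
  obtain ⟨τ₀, hτ₀, hτ₀K, hτ₀flow, hτ₀e⟩ :=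
    hq₀.exists_isLiftedFlow hQc hlsc hhom (hzero q₀ hq₀) (hmass q₀ hq₀ le_rfl)
  obtain ⟨σ, hσ, hσK, hσflow, hσmin⟩ :=
    exists_minimal_isLiftedFlow hQc hlsc ⟨τ₀, hτ₀, hτ₀K, hτ₀flow⟩
  obtain ⟨p, hp, hpσ⟩ := hσflow.exists_admissible hQc hlsc hconv hhom hσK
  refine ⟨p, hp, fun q hq => hpσ.trans ?_⟩
  rcases le_total (∫⁻ x, g x (q.2 x) ∂q.1) e₀ with hqe | hqe
  · obtain ⟨τ, hτ, hτK, hτflow, hτe⟩ :=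
      hq.exists_isLiftedFlow hQc hlsc hhom (hzero q hq) (hmass q hq hqe)
    exact (hσmin τ hτ hτK hτflow).trans hτe.le
  · exact ((hσmin τ₀ hτ₀ hτ₀K hτ₀flow).trans hτ₀e.le).trans hqe
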